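/- Let β > 0, ε ∈ ℝ, d ≥ 1, and fix φ, ξ ∈ ℝ^d with (φ,ξ) ≠ (0,0). There exists a constant C < ∞ depending only on β and ε (in particular not on φ, ξ) such that for every integrable function f : ℝ → ℂ, the function g : ℝ → ℂ defined by g(t) = W(t,φ,ξ)^ε · ∫_{−∞}^t K(t,s,φ,ξ) · W(s,φ,ξ)^{−ε} · f(s) ds is continuous on ℝ, tends to 0 as t → +∞ and as t → −∞, and satisfies sup_{t∈ℝ} |g(t)| ≤ C · ∫_ℝ |f(s)| ds. -/

import Mathlib

open MeasureTheory Real Filter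

/-- The weight `W(t,φ,ξ) = max(‖ξ - tφ‖, ‖φ‖^{1/(1+2β)})`. -/
noncomputable def Wgt (β : ℝ) {d : ℕ} (t : ℝ) (φ ξ : EuclideanSpace ℝ (Fin d)) : ℝ :=
  max ‖ξ - t • φ‖ (‖φ‖ ^ (1 / (1 + 2 * β)))

/-- The Kolmogorov kernel `K(t,s,φ,ξ) = exp(-∫_s^t ‖ξ - τφ‖^{2β} dτ)`. -/
noncomputable def Kker (β : ℝ) {d : ℕ} (t s : ℝ) (φ ξ : EuclideanSpace ℝ (Fin d)) : ℝ :=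
  Real.exp (-(∫ τ in s..t, ‖ξ - τ • φ‖ ^ (2 * β)))

/-- The function `g(t) = W(t)^ε ∫_{-∞}^t K(t,s) W(s)^{-ε} f(s) ds`. -/
noncomputable def Tfun (β ε : ℝ) {d : ℕ} (φ ξ : EuclideanSpace ℝ (Fin d))
    (f : ℝ → ℂ) (t : ℝ) : ℂ :=
  (↑(Wgt β t φ ξ ^ ε) : ℂ) *
    ∫ s in Set.Iic t, (↑(Kker β t s φ ξ * Wgt β s φ ξ ^ (-ε)) : ℂ) * f s

theorem Wgt_continuous (β : ℝ) {d : ℕ} (φ ξ : EuclideanSpace ℝ (Fin d)) :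
    Continuous fun t => Wgt β t φ ξ := by
  unfold Wgt
  fun_prop

theorem Wgt_pos (β : ℝ) {d : ℕ} {φ ξ : EuclideanSpace ℝ (Fin d)} (h : (φ, ξ) ≠ (0, 0)) (t : ℝ) :
    0 < Wgt β t φ ξ := by
  unfold Wgt
  by_cases hφ : φ = 0
  · have hξ : ξ ≠ 0 := fun hξ => h (by rw [hφ, hξ])
    exact lt_max_of_lt_left (by simpa [hφ] using hξ)
  · exact lt_max_of_lt_right (rpow_pos_of_pos (norm_pos_iff.mpr hφ) _)

theorem Wgt_le_add (β : ℝ) {d : ℕ} (φ ξ : EuclideanSpace ℝ (Fin d)) (a b : ℝ) :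
    Wgt β b φ ξ ≤ Wgt β a φ ξ + ‖φ‖ * |b - a| := by
  have h : ‖ξ - b • φ‖ ≤ ‖ξ - a • φ‖ + ‖φ‖ * |b - a| := by
    have : ξ - b • φ = (ξ - a • φ) - (b - a) • φ := by module
    rw [this, mul_comm, ← Real.norm_eq_abs, ← norm_smul]
    exact norm_sub_le _ _
  have h0 : 0 ≤ ‖φ‖ * |b - a| := by positivity
  unfold Wgt
  refine max_le (h.trans ?_) ?_
  · gcongr
    exact le_max_left _ _
  · exact (le_max_right _ _).trans (le_add_of_nonneg_right h0)

theorem continuous_norm_sub_smul_rpow {β : ℝ} (hβ : 0 < β) {d : ℕ}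
    (φ ξ : EuclideanSpace ℝ (Fin d)) : Continuous fun τ : ℝ => ‖ξ - τ • φ‖ ^ (2 * β) :=
  Continuous.rpow_const (by fun_prop) fun _ => Or.inr (by positivity)

theorem Kker_continuous_left {β : ℝ} (hβ : 0 < β) {d : ℕ} (φ ξ : EuclideanSpace ℝ (Fin d))
    (s : ℝ) : Continuous fun t => Kker β t s φ ξ := by
  unfold Kker
  exact continuous_exp.comp (intervalIntegral.continuous_primitive
    (fun _ _ => (continuous_norm_sub_smul_rpow hβ φ ξ).intervalIntegrable _ _) s).neg

theorem Kker_continuous_right {β : ℝ} (hβ : 0 < β) {d : ℕ} (φ ξ : EuclideanSpace ℝ (Fin d))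
    (t : ℝ) : Continuous fun s => Kker β t s φ ξ := by
  unfold Kker
  simp_rw [intervalIntegral.integral_symm t, neg_neg]
  exact continuous_exp.comp (intervalIntegral.continuous_primitive
    (fun _ _ => (continuous_norm_sub_smul_rpow hβ φ ξ).intervalIntegrable _ _) t)

theorem Kker_nonneg (β : ℝ) {d : ℕ} (φ ξ : EuclideanSpace ℝ (Fin d)) (s t : ℝ) :
    0 ≤ Kker β t s φ ξ :=
  (exp_pos _).le

theorem Kker_le_one (β : ℝ) {d : ℕ} (φ ξ : EuclideanSpace ℝ (Fin d)) {s t : ℝ} (hst : s ≤ t) :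
    Kker β t s φ ξ ≤ 1 := by
  unfold Kker
  rw [exp_le_one_iff, neg_nonpos]
  exact intervalIntegral.integral_nonneg hst fun _ _ => by positivity

theorem mul_rpow_le_integral_norm_sub_smul_rpow {β : ℝ} (hβ : 0 < β) {d : ℕ}
    (φ ξ : EuclideanSpace ℝ (Fin d)) {s t u v ρ : ℝ} (hsu : s ≤ u) (huv : u ≤ v) (hvt : v ≤ t)
    (hρ : 0 ≤ ρ) (h : ∀ τ ∈ Set.Icc u v, ρ ≤ ‖ξ - τ • φ‖) :
    (v - u) * ρ ^ (2 * β) ≤ ∫ τ in s..t, ‖ξ - τ • φ‖ ^ (2 * β) := by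
  have hc := continuous_norm_sub_smul_rpow hβ φ ξ
  calc (v - u) * ρ ^ (2 * β) = ∫ _ in u..v, ρ ^ (2 * β) := by simp
    _ ≤ ∫ τ in u..v, ‖ξ - τ • φ‖ ^ (2 * β) :=
        intervalIntegral.integral_mono_on huv (by simp) (hc.intervalIntegrable _ _)
          fun τ hτ => rpow_le_rpow hρ (h τ hτ) (by positivity)
    _ ≤ ∫ τ in s..t, ‖ξ - τ • φ‖ ^ (2 * β) :=
        intervalIntegral.integral_mono_interval hsu huv hvt
          (Eventually.of_forall fun _ => by positivity) (hc.intervalIntegrable _ _)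

/-- If the weight more than doubles between the endpoints of an interval, in either direction,
then the exponent of the Kolmogorov kernel controls a power of the ratio of the weights. -/
theorem mul_ratio_rpow_le_integral {β : ℝ} (hβ : 0 < β) {d : ℕ}
    {φ ξ : EuclideanSpace ℝ (Fin d)} (h0 : (φ, ξ) ≠ (0, 0)) {s t a b : ℝ} (hst : s ≤ t)
    (hab : a = s ∧ b = t ∨ a = t ∧ b = s) (h2 : 2 * Wgt β a φ ξ < Wgt β b φ ξ) :
    (1 / 4 * (1 / 2) ^ (2 * β)) * (Wgt β b φ ξ / Wgt β a φ ξ) ^ (1 + 2 * β) ≤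
      ∫ τ in s..t, ‖ξ - τ • φ‖ ^ (2 * β) := by
  have ha := Wgt_pos β h0 a
  have hb := Wgt_pos β h0 b
  have hlip := Wgt_le_add β φ ξ a b
  have habs : |b - a| = t - s := by
    rcases hab with ⟨rfl, rfl⟩ | ⟨rfl, rfl⟩
    · exact abs_of_nonneg (by linarith)
    · rw [abs_sub_comm]; exact abs_of_nonneg (by linarith)
  have hφ : 0 < ‖φ‖ := by
    rcases (norm_nonneg φ).eq_or_lt with h | h
    · rw [← h] at hlip; linarith
    · exact h
  set m := ‖φ‖ ^ (1 / (1 + 2 * β)) with hm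
  have hmpos : 0 < m := rpow_pos_of_pos hφ _
  have hma : m ≤ Wgt β a φ ξ := le_max_right _ _
  have hmφ : m ^ (1 + 2 * β) = ‖φ‖ := by
    rw [hm, ← rpow_mul hφ.le, one_div_mul_cancel (by positivity), rpow_one]
  set ρ := Wgt β b φ ξ with hρ
  have hbρ : ρ = ‖ξ - b • φ‖ := by
    rcases max_choice ‖ξ - b • φ‖ m with h | h
    · exact h
    · have : ρ = m := h
      linarith
  have hδ : ρ / (4 * ‖φ‖) ≤ t - s := by
    rw [div_le_iff₀ (by positivity)]
    rw [habs] at hlip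
    nlinarith
  have hδ0 : 0 ≤ ρ / (4 * ‖φ‖) := by positivity
  have hnear : ∀ τ, |τ - b| ≤ ρ / (4 * ‖φ‖) → ρ / 2 ≤ ‖ξ - τ • φ‖ := by
    intro τ hτ
    have h1 : ρ ≤ ‖ξ - τ • φ‖ + |τ - b| * ‖φ‖ := by
      have : ξ - b • φ = (ξ - τ • φ) + (τ - b) • φ := by module
      rw [hbρ, this, ← Real.norm_eq_abs, ← norm_smul]
      exact norm_add_le _ _
    have h3 : |τ - b| * ‖φ‖ ≤ ρ / 4 := by
      rw [le_div_iff₀ (by positivity)] at hτ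
      linarith
    linarith
  have key : ρ / (4 * ‖φ‖) * (ρ / 2) ^ (2 * β) ≤ ∫ τ in s..t, ‖ξ - τ • φ‖ ^ (2 * β) := by
    rcases hab with ⟨-, rfl⟩ | ⟨-, rfl⟩
    · have := mul_rpow_le_integral_norm_sub_smul_rpow hβ φ ξ (s := s) (t := b)
        (u := b - ρ / (4 * ‖φ‖)) (v := b) (ρ := ρ / 2) (by linarith) (by linarith) le_rfl
        (by positivity) fun τ hτ => hnear τ (by rw [abs_le]; constructor <;> linarith [hτ.1, hτ.2])
      simpa using this
    · have := mul_rpow_le_integral_norm_sub_smul_rpow hβ φ ξ (s := b) (t := t)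
        (u := b) (v := b + ρ / (4 * ‖φ‖)) (ρ := ρ / 2) le_rfl (by linarith) (by linarith)
        (by positivity) fun τ hτ => hnear τ (by rw [abs_le]; constructor <;> linarith [hτ.1, hτ.2])
      simpa using this
  calc (1 / 4 * (1 / 2) ^ (2 * β)) * (ρ / Wgt β a φ ξ) ^ (1 + 2 * β)
      ≤ (1 / 4 * (1 / 2) ^ (2 * β)) * (ρ / m) ^ (1 + 2 * β) := by gcongr
    _ = ρ / (4 * ‖φ‖) * (ρ / 2) ^ (2 * β) := by
        rw [div_rpow hb.le hmpos.le, hmφ, rpow_add hb, rpow_one, div_eq_mul_one_div ρ 2,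
          mul_rpow hb.le (by norm_num)]
        field_simp
    _ ≤ _ := key

/-- The function `x ↦ x ^ |ε| * exp (-c x ^ p)` with the constants produced by
`mul_ratio_rpow_le_integral`. -/
noncomputable def ratioDecay (β ε x : ℝ) : ℝ :=
  x ^ |ε| * Real.exp (-((1 / 4 * (1 / 2) ^ (2 * β)) * x ^ (1 + 2 * β)))

theorem tendsto_ratioDecay {β : ℝ} (hβ : 0 < β) (ε : ℝ) :
    Tendsto (ratioDecay β ε) atTop (nhds 0) := by
  have hp : 0 < 1 + 2 * β := by positivity
  have h := (tendsto_rpow_mul_exp_neg_mul_atTop_nhds_zero (|ε| / (1 + 2 * β))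
    (1 / 4 * (1 / 2) ^ (2 * β)) (by positivity)).comp (tendsto_rpow_atTop hp)
  refine h.congr' ?_
  filter_upwards [eventually_ge_atTop 0] with x hx
  simp only [Function.comp, ratioDecay]
  rw [← rpow_mul hx, mul_div_cancel₀ _ hp.ne', neg_mul]

theorem exists_ratioDecay_le {β : ℝ} (hβ : 0 < β) (ε : ℝ) :
    ∃ C : ℝ, ∀ x, 0 ≤ x → ratioDecay β ε x ≤ C := by
  obtain ⟨N, hN⟩ := eventually_atTop.mp
    ((tendsto_ratioDecay hβ ε).eventually (eventually_le_nhds one_pos))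
  refine ⟨max 1 (N ^ |ε|), fun x hx => ?_⟩
  rcases le_total N x with h | h
  · exact (hN x h).trans (le_max_left _ _)
  · refine le_trans ?_ (le_max_right _ _)
    calc ratioDecay β ε x ≤ x ^ |ε| * 1 := by
          unfold ratioDecay
          gcongr
          rw [exp_le_one_iff, neg_nonpos]
          positivity
      _ ≤ N ^ |ε| := by
          rw [mul_one]
          gcongr

theorem rpow_le_rpow_abs {x : ℝ} (hx : 1 ≤ x) (ε : ℝ) : x ^ ε ≤ x ^ |ε| :=
  rpow_le_rpow_of_exponent_le hx (le_abs_self ε)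

theorem ratio_rpow_symm {x y : ℝ} (hx : 0 < x) (hy : 0 < y) (ε : ℝ) :
    (x / y) ^ ε = (y / x) ^ (-ε) := by
  rw [rpow_neg (by positivity), ← inv_rpow (by positivity), inv_div]

theorem ratio_rpow_mul_Kker_le_of_two_mul_lt {β : ℝ} (hβ : 0 < β) (ε : ℝ) {d : ℕ}
    {φ ξ : EuclideanSpace ℝ (Fin d)} (h0 : (φ, ξ) ≠ (0, 0)) {s t a b : ℝ} (hst : s ≤ t)
    (hab : a = s ∧ b = t ∨ a = t ∧ b = s) (h2 : 2 * Wgt β a φ ξ < Wgt β b φ ξ) :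
    (Wgt β b φ ξ / Wgt β a φ ξ) ^ ε * Kker β t s φ ξ ≤
      ratioDecay β ε (Wgt β b φ ξ / Wgt β a φ ξ) := by
  have ha := Wgt_pos β h0 a
  have hR : 1 ≤ Wgt β b φ ξ / Wgt β a φ ξ := by rw [one_le_div ha]; linarith
  unfold ratioDecay Kker
  gcongr
  · exact le_abs_self ε
  · exact mul_ratio_rpow_le_integral hβ h0 hst hab h2

theorem exists_ratio_rpow_mul_Kker_le {β : ℝ} (hβ : 0 < β) (ε : ℝ) :
    ∃ C : ℝ, ∀ (d : ℕ) (φ ξ : EuclideanSpace ℝ (Fin d)), (φ, ξ) ≠ (0, 0) →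
      ∀ s t, s ≤ t → (Wgt β t φ ξ / Wgt β s φ ξ) ^ ε * Kker β t s φ ξ ≤ C := by
  obtain ⟨C₁, hC₁⟩ := exists_ratioDecay_le hβ ε
  obtain ⟨C₂, hC₂⟩ := exists_ratioDecay_le hβ (-ε)
  refine ⟨max (max C₁ C₂) (2 ^ |ε|), fun d φ ξ h0 s t hst => ?_⟩
  have hs := Wgt_pos β h0 s
  have ht := Wgt_pos β h0 t
  by_cases h1 : 2 * Wgt β s φ ξ < Wgt β t φ ξ
  · exact ((ratio_rpow_mul_Kker_le_of_two_mul_lt hβ ε h0 hst (Or.inl ⟨rfl, rfl⟩) h1).trans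
      (hC₁ _ (by positivity))).trans ((le_max_left _ _).trans (le_max_left _ _))
  by_cases h2 : 2 * Wgt β t φ ξ < Wgt β s φ ξ
  · rw [ratio_rpow_symm ht hs]
    exact ((ratio_rpow_mul_Kker_le_of_two_mul_lt hβ (-ε) h0 hst (Or.inr ⟨rfl, rfl⟩) h2).trans
      (hC₂ _ (by positivity))).trans ((le_max_right _ _).trans (le_max_left _ _))
  refine le_trans ?_ (le_max_right _ _)
  push Not at h1 h2
  calc (Wgt β t φ ξ / Wgt β s φ ξ) ^ ε * Kker β t s φ ξ
      ≤ (Wgt β t φ ξ / Wgt β s φ ξ) ^ ε * 1 := by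
        gcongr
        exact Kker_le_one β φ ξ hst
    _ ≤ 2 ^ |ε| := by
        rw [mul_one]
        rcases le_total (Wgt β s φ ξ) (Wgt β t φ ξ) with h | h
        · refine (rpow_le_rpow_abs ((one_le_div hs).mpr h) ε).trans ?_
          gcongr
          rwa [div_le_iff₀ hs]
        · rw [ratio_rpow_symm ht hs, ← abs_neg ε]
          refine (rpow_le_rpow_abs ((one_le_div ht).mpr h) (-ε)).trans ?_
          gcongr
          rwa [div_le_iff₀ ht]

theorem tendsto_ratio_rpow_mul_Kker_atTop {β : ℝ} (hβ : 0 < β) (ε : ℝ) {d : ℕ}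
    {φ ξ : EuclideanSpace ℝ (Fin d)} (h0 : (φ, ξ) ≠ (0, 0)) (s : ℝ) :
    Tendsto (fun t => (Wgt β t φ ξ / Wgt β s φ ξ) ^ ε * Kker β t s φ ξ) atTop (nhds 0) := by
  have hs := Wgt_pos β h0 s
  by_cases hφ : φ = 0
  · have hξ : ξ ≠ 0 := fun hξ => h0 (by rw [hφ, hξ])
    have hW : ∀ t, Wgt β t φ ξ = Wgt β s φ ξ := fun t => by simp [Wgt, hφ]
    have hpos : 0 < ‖ξ‖ ^ (2 * β) := rpow_pos_of_pos (norm_pos_iff.mpr hξ) _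
    have hK : ∀ t, Kker β t s φ ξ = Real.exp (-((t - s) * ‖ξ‖ ^ (2 * β))) := fun t => by
      simp [Kker, hφ]
    simp_rw [hW, hK, div_self hs.ne', one_rpow, one_mul]
    exact tendsto_exp_neg_atTop_nhds_zero.comp
      ((tendsto_atTop_add_const_right atTop (-s) tendsto_id).atTop_mul_const hpos)
  · have hφ' : 0 < ‖φ‖ := norm_pos_iff.mpr hφ
    have hW : Tendsto (fun t => Wgt β t φ ξ) atTop atTop := by
      refine tendsto_atTop_mono (f := fun t => t * ‖φ‖ + -‖ξ‖) (fun t => ?_)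
        (tendsto_atTop_add_const_right atTop _ (tendsto_id.atTop_mul_const hφ'))
      have h1 : t * ‖φ‖ ≤ ‖t • φ‖ := by
        rw [norm_smul]
        gcongr
        exact le_abs_self t
      have h2 : ‖t • φ‖ - ‖ξ‖ ≤ ‖ξ - t • φ‖ := by
        rw [norm_sub_rev]
        exact norm_sub_norm_le _ _
      exact le_trans (by linarith) (le_max_left _ _)
    refine squeeze_zero' (Eventually.of_forall fun t => ?_) ?_
      ((tendsto_ratioDecay hβ ε).comp (hW.atTop_div_const hs))
    · have ht := Wgt_pos β h0 t
      exact mul_nonneg (by positivity) (Kker_nonneg β φ ξ s t)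
    · filter_upwards [eventually_ge_atTop s, hW.eventually_gt_atTop (2 * Wgt β s φ ξ)]
        with t hst h2
      exact ratio_rpow_mul_Kker_le_of_two_mul_lt hβ ε h0 hst (Or.inl ⟨rfl, rfl⟩) h2

/-- A bounded causal kernel, separately continuous and decaying in its first variable, maps
integrable functions to continuous functions vanishing at infinity. -/
theorem causal_kernel_L1_to_C0 {M : ℝ → ℝ → ℝ} {C : ℝ} (hl : ∀ s, Continuous fun t => M t s)
    (hr : ∀ t, Continuous (M t)) (hM : ∀ s t, s ≤ t → |M t s| ≤ C)
    (hlim : ∀ s, Tendsto (fun t => M t s) atTop (nhds 0)) {f : ℝ → ℂ} (hf : Integrable f) :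
    Continuous (fun t => ∫ s in Set.Iic t, (M t s : ℂ) * f s) ∧
      Tendsto (fun t => ∫ s in Set.Iic t, (M t s : ℂ) * f s) atTop (nhds 0) ∧
      Tendsto (fun t => ∫ s in Set.Iic t, (M t s : ℂ) * f s) atBot (nhds 0) ∧
      ∀ t, ‖∫ s in Set.Iic t, (M t s : ℂ) * f s‖ ≤ C * ∫ s, ‖f s‖ := by
  have hC : 0 ≤ C := (abs_nonneg _).trans (hM 0 0 le_rfl)
  set F : ℝ → ℝ → ℂ := fun t => (Set.Iic t).indicator fun s => (M t s : ℂ) * f s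
  have hF_le : ∀ {t s}, s ≤ t → F t s = (M t s : ℂ) * f s := fun h =>
    Set.indicator_of_mem (Set.mem_Iic.mpr h) _
  have hF_lt : ∀ {t s}, t < s → F t s = 0 := fun h =>
    Set.indicator_of_notMem (Set.notMem_Iic.mpr h) _
  have hint : ∀ t, ∫ s in Set.Iic t, (M t s : ℂ) * f s = ∫ s, F t s := fun t =>
    (integral_indicator measurableSet_Iic).symm
  have hmeas : ∀ t, AEStronglyMeasurable (F t) := fun t =>
    ((Complex.continuous_ofReal.comp (hr t)).aestronglyMeasurable.mul
      hf.aestronglyMeasurable).indicator measurableSet_Iic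
  have hbound : ∀ t s, ‖F t s‖ ≤ C * ‖f s‖ := fun t s => by
    by_cases h : s ≤ t
    · rw [hF_le h, norm_mul, Complex.norm_real, Real.norm_eq_abs]
      gcongr
      exact hM s t h
    · rw [hF_lt (not_le.mp h), norm_zero]
      positivity
  have hdom : Integrable fun s => C * ‖f s‖ := hf.norm.const_mul C
  have hevent : ∀ s t, s < t → ∀ᶠ r in nhds t, (M r s : ℂ) * f s = F r s := fun s t h => by
    filter_upwards [lt_mem_nhds h] with r hr
    rw [hF_le (le_of_lt hr)]
  simp_rw [hint]
  refine ⟨?_, ?_, ?_, fun t => ?_⟩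
  · rw [continuous_iff_continuousAt]
    intro t
    refine continuousAt_of_dominated (Eventually.of_forall hmeas)
      (Eventually.of_forall fun r => Eventually.of_forall (hbound r)) hdom ?_
    filter_upwards [Measure.ae_ne volume t] with s hs
    rcases lt_or_gt_of_ne hs with h | h
    · refine ContinuousAt.congr ?_ (hevent s t h)
      exact ((Complex.continuous_ofReal.comp (hl s)).mul continuous_const).continuousAt
    · refine (continuousAt_const (y := (0 : ℂ))).congr ?_
      filter_upwards [gt_mem_nhds h] with r hr
      rw [hF_lt hr]
  · rw [← integral_zero ℝ ℂ]
    refine tendsto_integral_filter_of_dominated_convergence _ (Eventually.of_forall hmeas)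
      (Eventually.of_forall fun r => Eventually.of_forall (hbound r)) hdom
      (Eventually.of_forall fun s => ?_)
    have h : Tendsto (fun t => (M t s : ℂ) * f s) atTop (nhds 0) := by
      simpa using ((Complex.continuous_ofReal.tendsto 0).comp (hlim s)).mul_const (f s)
    refine h.congr' ?_
    filter_upwards [eventually_ge_atTop s] with r hr
    rw [hF_le hr]
  · rw [← integral_zero ℝ ℂ]
    refine tendsto_integral_filter_of_dominated_convergence _ (Eventually.of_forall hmeas)
      (Eventually.of_forall fun r => Eventually.of_forall (hbound r)) hdom
      (Eventually.of_forall fun s => ?_)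
    refine tendsto_const_nhds.congr' ?_
    filter_upwards [eventually_lt_atBot s] with r hr
    rw [hF_lt hr]
  · rw [← integral_const_mul]
    exact norm_integral_le_of_norm_le hdom (Eventually.of_forall (hbound t))

theorem Tfun_eq_setIntegral (β ε : ℝ) {d : ℕ} {φ ξ : EuclideanSpace ℝ (Fin d)}
    (h0 : (φ, ξ) ≠ (0, 0)) (f : ℝ → ℂ) :
    Tfun β ε φ ξ f = fun t => ∫ s in Set.Iic t,
      (((Wgt β t φ ξ / Wgt β s φ ξ) ^ ε * Kker β t s φ ξ : ℝ) : ℂ) * f s := by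
  funext t
  rw [Tfun, ← integral_const_mul]
  congr 1
  funext s
  rw [div_rpow (Wgt_pos β h0 t).le (Wgt_pos β h0 s).le, rpow_neg (Wgt_pos β h0 s).le]
  push_cast
  ring

/-- Proposition 2.17, first mapping property: `W^ε T W^{-ε} : L¹ → C₀(ℝ)` is bounded,
with a constant depending only on `β` and `ε` (not on `φ, ξ`). -/
theorem weighted_duhamel_L1_to_C0 (β ε : ℝ) (hβ : 0 < β) :
    ∃ C : ℝ,
      ∀ (d : ℕ), 1 ≤ d → ∀ φ ξ : EuclideanSpace ℝ (Fin d), (φ, ξ) ≠ (0, 0) →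
        ∀ f : ℝ → ℂ, Integrable f →
          Continuous (Tfun β ε φ ξ f) ∧
          Tendsto (Tfun β ε φ ξ f) atTop (nhds 0) ∧
          Tendsto (Tfun β ε φ ξ f) atBot (nhds 0) ∧
          ∀ t : ℝ, ‖Tfun β ε φ ξ f t‖ ≤ C * ∫ s : ℝ, ‖f s‖ := by
  obtain ⟨C, hC⟩ := exists_ratio_rpow_mul_Kker_le hβ ε
  refine ⟨C, fun d _ φ ξ h0 f hf => ?_⟩
  have hW := Wgt_pos β h0
  have hWc := Wgt_continuous β φ ξ
  rw [Tfun_eq_setIntegral β ε h0 f]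
  refine causal_kernel_L1_to_C0 (M := fun t s => (Wgt β t φ ξ / Wgt β s φ ξ) ^ ε * Kker β t s φ ξ)
    (fun s => ?_) (fun t => ?_) (fun s t hst => ?_)
    (fun s => tendsto_ratio_rpow_mul_Kker_atTop hβ ε h0 s) hf
  · exact ((hWc.div_const _).rpow_const fun t => Or.inl (div_pos (hW t) (hW s)).ne').mul
      (Kker_continuous_left hβ φ ξ s)
  · exact ((continuous_const.div hWc fun s => (hW s).ne').rpow_const
      fun s => Or.inl (div_pos (hW t) (hW s)).ne').mul (Kker_continuous_right hβ φ ξ t)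
  · rw [abs_of_nonneg (mul_nonneg (rpow_nonneg (div_pos (hW t) (hW s)).le _)
      (Kker_nonneg β φ ξ s t))]
    exact hC d φ ξ h0 s t hst
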